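/- Let 𝒯 be a geodesic tube of direction β∨ = ω_i∨ and let w_min be its hyperbolic generator, with v_{w_min} = c_{w_min} β∨. Then c_{w_min} = (ω_i∨, α_i∨)/(ω_i∨, ω_i∨). -/

import Mathlib

open scoped RealInnerProductSpace

noncomputable section

/-- The ambient Euclidean space of rank `m`.  Via the fixed `W`-invariant inner product we
identify the space `V` containing the root system with its dual `V*`; the affine space `A`
underlying `V*` is then the Euclidean space itself. -/
abbrev E (m : ℕ) := EuclideanSpace ℝ (Fin m)

variable {m : ℕ}

/-- The coroot `α∨ = 2α/(α,α)` of a vector `α` (under the identification of `V` with `V*`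
given by the invariant inner product). -/
def coroot (α : E m) : E m := (2 / ⟪α, α⟫) • α

/-- The affine reflection `s_{α,k}(x) = x - (⟨α,x⟩ - k) α∨` as a function. -/
def affReflFun (α : E m) (k : ℤ) : E m → E m := fun x => x - (⟪α, x⟫ - (k : ℝ)) • coroot α

lemma affReflFun_involutive (α : E m) (k : ℤ) : Function.Involutive (affReflFun α k) := by
  intro x
  by_cases h : α = 0
  · simp [affReflFun, coroot, h]
  · have hαα : ⟪α, α⟫ ≠ (0:ℝ) := (inner_self_ne_zero (𝕜 := ℝ)).mpr h
    have h2 : ⟪α, coroot α⟫ = (2:ℝ) := by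
      unfold coroot
      rw [real_inner_smul_right, div_mul_cancel₀ _ hαα]
    have key : ∀ y : E m, ∀ s : ℝ, ⟪α, y - s • coroot α⟫ = ⟪α, y⟫ - 2 * s := by
      intro y s
      rw [inner_sub_right, real_inner_smul_right, h2]
      ring
    show affReflFun α k (x - (⟪α, x⟫ - (k:ℝ)) • coroot α) = x
    unfold affReflFun
    rw [key]
    rw [sub_sub, ← add_smul]
    rw [show (⟪α, x⟫ - (k:ℝ)) + (⟪α, x⟫ - 2 * (⟪α, x⟫ - (k:ℝ)) - (k:ℝ)) = 0 by ring]
    simp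

/-- The affine reflection `s_{α,k}` as a permutation of the affine space. -/
def affRefl (α : E m) (k : ℤ) : Equiv.Perm (E m) := (affReflFun_involutive α k).toPerm

/-- The affine Weyl group of a set of roots `Φ`: the group generated by all affine
reflections `s_{α,k}`, `α ∈ Φ`, `k ∈ ℤ`. -/
def Waff (Φ : Set (E m)) : Subgroup (Equiv.Perm (E m)) :=
  Subgroup.closure {w | ∃ α ∈ Φ, ∃ k : ℤ, w = affRefl α k}

/-- `Φ` is a reduced (crystallographic) root system spanning the ambient space. -/
structure IsRootSystem (Φ : Set (E m)) : Prop where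
  finite : Φ.Finite
  ne_zero : ∀ α ∈ Φ, α ≠ (0 : E m)
  span_eq_top : Submodule.span ℝ Φ = ⊤
  reflect_mem : ∀ α ∈ Φ, ∀ β ∈ Φ, β - ⟪α, β⟫ • coroot α ∈ Φ
  crystallographic : ∀ α ∈ Φ, ∀ β ∈ Φ, ∃ z : ℤ, ⟪α, coroot β⟫ = (z : ℝ)
  reduced : ∀ α ∈ Φ, ∀ t : ℝ, t • α ∈ Φ → t = 1 ∨ t = -1

/-- `B` is a system of simple roots of `Φ`. -/
structure IsSimpleSystem (Φ : Set (E m)) (B : Fin m → E m) : Prop where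
  mem : ∀ i, B i ∈ Φ
  indep : LinearIndependent ℝ B
  decomp : ∀ α ∈ Φ, (∃ c : Fin m → ℤ, α = ∑ j, (c j : ℝ) • B j ∧ ∀ j, 0 ≤ c j) ∨
                    (∃ c : Fin m → ℤ, α = ∑ j, (c j : ℝ) • B j ∧ ∀ j, c j ≤ 0)

/-- `ω` is the system of fundamental coweights relative to the simple roots `B`,
i.e. `⟨α_i, ω_j∨⟩ = δ_{ij}`. -/
def IsFundamentalCoweights (B ω : Fin m → E m) : Prop :=
  ∀ i j, ⟪B i, ω j⟫ = if i = j then (1 : ℝ) else 0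

/-- The wall `H_{α,k} = {x : ⟨α,x⟩ = k}`. -/
def wall (α : E m) (k : ℤ) : Set (E m) := {x | ⟪α, x⟫ = (k : ℝ)}

/-- The union of all walls of the root system `Φ`. -/
def allWalls (Φ : Set (E m)) : Set (E m) := ⋃ α ∈ Φ, ⋃ k : ℤ, wall α k

/-- An alcove: a connected component of the complement of the union of all walls. -/
def IsAlcove (Φ : Set (E m)) (C : Set (E m)) : Prop :=
  ∃ x ∈ (allWalls Φ)ᶜ, C = connectedComponentIn (allWalls Φ)ᶜ x

/-- The set `𝒲` of walls removed when forming geodesic tubes of direction `β∨`: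
all walls `H_{α,k}` with `⟨α, β∨⟩ = 0` (equivalently `α ∈ Φ_I`). -/
def tubeWalls (Φ : Set (E m)) (β : E m) : Set (E m) :=
  ⋃ α ∈ {α ∈ Φ | ⟪α, β⟫ = (0:ℝ)}, ⋃ k : ℤ, wall α k

/-- A geodesic tube of direction `β∨`: a connected component of `A ∖ ⋃𝒲`. -/
def IsGeodesicTube (Φ : Set (E m)) (β : E m) (T : Set (E m)) : Prop :=
  ∃ x ∈ (tubeWalls Φ β)ᶜ, T = connectedComponentIn (tubeWalls Φ β)ᶜ x

/-- `d_γ = inf_x d(x, γx)`. -/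
def minDisp (f : E m → E m) : ℝ := ⨅ x, dist x (f x)

/-- `Min(γ) = {x : d(x,γx) = d_γ}`. -/
def minSet (f : E m → E m) : Set (E m) := {x | dist x (f x) = minDisp f}

/-- A hyperbolic isometry: semisimple (`Min` nonempty) with `d_γ > 0`. -/
def IsHyperbolic (f : E m → E m) : Prop := (minSet f).Nonempty ∧ 0 < minDisp f

/-- `v` is the vector by which `γ` translates its min set. -/
def HasTransVec (f : E m → E m) (v : E m) : Prop := ∀ x ∈ minSet f, f x = x + v

/-- `x` is the barycenter of the polysimplex `s`: the average of the vertices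
(extreme points of the closure) of `s`. -/
def IsBarycenter (s : Set (E m)) (x : E m) : Prop :=
  ∃ F : Finset (E m), (F : Set (E m)) = Set.extremePoints ℝ (closure s) ∧ F.Nonempty ∧
    x = (F.card : ℝ)⁻¹ • ∑ y ∈ F, y

/-- The centerline `ℒ = x + ℝ β∨`. -/
def centerline (x β : E m) : Set (E m) := {p | ∃ t : ℝ, p = x + t • β}


/-- `w` is a hyperbolic element of the affine Weyl group stabilizing the tube `T`. -/
def IsHypStab (Φ : Set (E m)) (T : Set (E m)) (w : Equiv.Perm (E m)) : Prop :=
  w ∈ Waff Φ ∧ IsHyperbolic (w : E m → E m) ∧ (w : E m → E m) '' T = T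

/-! ### Affine description of elements of the affine Weyl group -/

lemma inner_coroot_right (x α : E m) : ⟪x, coroot α⟫ = (2 / ⟪α, α⟫) * ⟪x, α⟫ := by
  unfold coroot
  rw [real_inner_smul_right]

lemma inner_coroot_self {α : E m} (h : α ≠ 0) : ⟪α, coroot α⟫ = (2:ℝ) := by
  rw [inner_coroot_right, div_mul_cancel₀ _ ((inner_self_ne_zero (𝕜 := ℝ)).mpr h)]

lemma affRefl_apply (α : E m) (k : ℤ) (x : E m) :
    affRefl α k x = x - (⟪α, x⟫ - (k : ℝ)) • coroot α := rfl

/-- `w` is a linear isometry permuting `Ψ` followed by a coroot lattice translation. -/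
def AffDesc (Ψ : Set (E m)) (w : E m → E m) : Prop :=
  ∃ L : E m ≃ₗᵢ[ℝ] E m, ∃ q ∈ AddSubgroup.closure (coroot '' Ψ),
    (∀ x, w x = L x + q) ∧ ∀ α ∈ Ψ, L α ∈ Ψ ∧ L.symm α ∈ Ψ

lemma map_coroot (L : E m ≃ₗᵢ[ℝ] E m) (α : E m) : L (coroot α) = coroot (L α) := by
  unfold coroot
  rw [L.inner_map_map, map_smul]

lemma map_lattice {Ψ : Set (E m)} (L : E m ≃ₗᵢ[ℝ] E m) (hL : ∀ α ∈ Ψ, L α ∈ Ψ) {q : E m}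
    (hq : q ∈ AddSubgroup.closure (coroot '' Ψ)) : L q ∈ AddSubgroup.closure (coroot '' Ψ) := by
  induction hq using AddSubgroup.closure_induction with
  | mem x hx =>
    obtain ⟨α, hα, rfl⟩ := hx
    rw [map_coroot]
    exact AddSubgroup.subset_closure ⟨_, hL α hα, rfl⟩
  | zero => simp
  | add x y _ _ hx hy => rw [map_add]; exact add_mem hx hy
  | neg x _ hx => rw [map_neg]; exact neg_mem hx

lemma affDesc_of_mem {Ψ : Set (E m)}
    (hr : ∀ α ∈ Ψ, ∀ β ∈ Ψ, β - ⟪α, β⟫ • coroot α ∈ Ψ)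
    {w : Equiv.Perm (E m)} (hw : w ∈ Waff Ψ) : AffDesc Ψ w := by
  unfold Waff at hw
  induction hw using Subgroup.closure_induction with
  | mem w hw =>
    obtain ⟨α, hα, k, rfl⟩ := hw
    have hrefl : ∀ x, (ℝ ∙ α)ᗮ.reflection x = x - ⟪α, x⟫ • coroot α := by
      intro x
      rw [Submodule.reflection_orthogonal_apply, Submodule.reflection_singleton_apply]
      unfold coroot
      simp only [RCLike.ofReal_real_eq_id, id, smul_smul, real_inner_self_eq_norm_sq, two_smul,
        ← add_smul]
      rw [neg_sub]
      congr 2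
      ring
    refine ⟨(ℝ ∙ α)ᗮ.reflection, (k : ℝ) • coroot α, ?_, ?_, ?_⟩
    · rw [Int.cast_smul_eq_zsmul]
      exact zsmul_mem (AddSubgroup.subset_closure (Set.mem_image_of_mem coroot hα)) k
    · intro x
      rw [hrefl, affRefl_apply, sub_smul]
      abel
    · intro β hβ
      rw [Submodule.reflection_symm, hrefl]
      exact ⟨hr α hα β hβ, hr α hα β hβ⟩
  | one =>
    exact ⟨LinearIsometryEquiv.refl ℝ _, 0, zero_mem _, by simp, fun α hα => ⟨hα, hα⟩⟩
  | mul u v _ _ hu hv =>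
    obtain ⟨L, q, hq, h1, h2⟩ := hu
    obtain ⟨L', q', hq', h1', h2'⟩ := hv
    refine ⟨L'.trans L, L q' + q, add_mem (map_lattice L (fun α h => (h2 α h).1) hq') hq, ?_, ?_⟩
    · intro x
      simp [h1, h1', add_assoc]
    · intro α hα
      exact ⟨(h2 _ (h2' α hα).1).1, (h2' _ (h2 α hα).2).2⟩
  | inv u _ hu =>
    obtain ⟨L, q, hq, h1, h2⟩ := hu
    refine ⟨L.symm, - L.symm q,
      neg_mem (map_lattice L.symm (fun α h => (h2 α h).2) hq), ?_, ?_⟩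
    · intro x
      rw [Equiv.Perm.inv_eq_iff_eq, h1]
      simp
    · intro α hα
      exact ⟨(h2 α hα).2, by simpa using (h2 α hα).1⟩

/-- The roots orthogonal to `β`. -/
def PhiI (Φ : Set (E m)) (β : E m) : Set (E m) := {α ∈ Φ | ⟪α, β⟫ = (0:ℝ)}

lemma PhiI_reflect {Φ : Set (E m)} (hΦ : IsRootSystem Φ) (β : E m) :
    ∀ α ∈ PhiI Φ β, ∀ γ ∈ PhiI Φ β, γ - ⟪α, γ⟫ • coroot α ∈ PhiI Φ β := by
  rintro α ⟨hα, hα'⟩ γ ⟨hγ, hγ'⟩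
  refine ⟨hΦ.reflect_mem α hα γ hγ, ?_⟩
  rw [inner_sub_left, hγ', real_inner_smul_left, real_inner_comm β (coroot α),
    inner_coroot_right, real_inner_comm α β, hα']
  simp

lemma inner_lattice_int {Φ Ψ : Set (E m)} (hΦ : IsRootSystem Φ) (hs : Ψ ⊆ Φ) {q : E m}
    (hq : q ∈ AddSubgroup.closure (coroot '' Ψ)) {α : E m} (hα : α ∈ Φ) :
    ∃ z : ℤ, ⟪α, q⟫ = (z : ℝ) := by
  induction hq using AddSubgroup.closure_induction with
  | mem x hx =>
    obtain ⟨γ, hγ, rfl⟩ := hx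
    exact hΦ.crystallographic α hα γ (hs hγ)
  | zero => exact ⟨0, by simp⟩
  | add x y _ _ hx hy =>
    obtain ⟨a, ha⟩ := hx
    obtain ⟨b, hb⟩ := hy
    exact ⟨a + b, by rw [inner_add_right, ha, hb]; push_cast; ring⟩
  | neg x _ hx =>
    obtain ⟨a, ha⟩ := hx
    exact ⟨-a, by rw [inner_neg_right, ha]; push_cast; ring⟩

/-- Pairings with `w x` are pairings with `x` up to integers. -/
lemma pair_of_mem {Φ Ψ : Set (E m)} (hΦ : IsRootSystem Φ) (hs : Ψ ⊆ Φ)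
    (hr : ∀ α ∈ Ψ, ∀ β ∈ Ψ, β - ⟪α, β⟫ • coroot α ∈ Ψ)
    {w : Equiv.Perm (E m)} (hw : w ∈ Waff Ψ) {α : E m} (hα : α ∈ Ψ) :
    ∃ γ ∈ Ψ, ∃ n : ℤ, ∀ x, ⟪α, w x⟫ = ⟪γ, x⟫ + (n : ℝ) := by
  obtain ⟨L, q, hq, h1, h2⟩ := affDesc_of_mem hr hw
  obtain ⟨n, hn⟩ := inner_lattice_int hΦ hs hq (hs hα)
  refine ⟨L.symm α, (h2 α hα).2, n, fun x => ?_⟩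
  rw [h1, inner_add_right, hn]
  congr 1
  rw [← L.inner_map_map (L.symm α) x, L.apply_symm_apply]

lemma inner_fix_of_mem {Φ : Set (E m)} {β : E m} {w : Equiv.Perm (E m)}
    (hw : w ∈ Waff (PhiI Φ β)) : ∀ x, ⟪β, w x⟫ = ⟪β, x⟫ := by
  unfold Waff at hw
  induction hw using Subgroup.closure_induction with
  | mem w hw =>
    obtain ⟨α, hα, k, rfl⟩ := hw
    intro x
    rw [affRefl_apply, inner_sub_right, real_inner_smul_right, inner_coroot_right,
      real_inner_comm α β, hα.2]
    simp
  | one => intro x; rfl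
  | mul u v _ _ hu hv => intro x; rw [Equiv.Perm.mul_apply, hu, hv]
  | inv u _ hu => intro x; rw [← hu (u⁻¹ x)]; simp

/-! ### Coroots are integral combinations of simple coroots -/

lemma span_simple {Φ : Set (E m)} {B : Fin m → E m} (hB : IsSimpleSystem Φ B) :
    Submodule.span ℝ (Set.range B) = ⊤ :=
  hB.indep.span_eq_top_of_card_eq_finrank' (by simp)

lemma eq_zero_of_inner_simple {Φ : Set (E m)} {B : Fin m → E m} (hB : IsSimpleSystem Φ B)
    {x : E m} (h : ∀ j, ⟪B j, x⟫ = (0:ℝ)) : x = 0 := by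
  have : ∀ y ∈ Submodule.span ℝ (Set.range B), ⟪y, x⟫ = (0:ℝ) := by
    intro y hy
    induction hy using Submodule.span_induction with
    | mem y hy => obtain ⟨j, rfl⟩ := hy; exact h j
    | zero => simp
    | add y z _ _ hy hz => rw [inner_add_left, hy, hz, add_zero]
    | smul a y _ hy => rw [real_inner_smul_left, hy, mul_zero]
  rw [span_simple hB] at this
  exact inner_self_eq_zero.mp (this x trivial)

lemma coroot_reflect (α γ : E m) (hα : α ≠ 0) :
    coroot (γ - ⟪α, γ⟫ • coroot α) = coroot γ - ⟪α, coroot γ⟫ • coroot α := by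
  have hn : ⟪γ - ⟪α, γ⟫ • coroot α, γ - ⟪α, γ⟫ • coroot α⟫ = (⟪γ, γ⟫ : ℝ) := by
    have h := (inner_self_ne_zero (𝕜 := ℝ)).mpr hα
    simp only [coroot, inner_sub_left, inner_sub_right, real_inner_smul_left,
      real_inner_smul_right, real_inner_comm γ α]
    field_simp
    ring
  rw [inner_coroot_right]
  conv_lhs => rw [coroot, hn]
  conv_rhs => rw [coroot]
  rw [smul_sub, smul_smul]

lemma coroot_neg (α : E m) : coroot (-α) = - coroot α := by
  simp [coroot]

lemma coroot_mem_pos {Φ : Set (E m)} (hΦ : IsRootSystem Φ) {B : Fin m → E m}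
    (hB : IsSimpleSystem Φ B) (N : ℕ) : ∀ c : Fin m → ℕ, (∑ j, c j) = N →
    (∑ j, (c j : ℝ) • B j) ∈ Φ →
    coroot (∑ j, (c j : ℝ) • B j) ∈ AddSubgroup.closure (Set.range fun j => coroot (B j)) := by
  induction N using Nat.strong_induction_on with
  | _ N ih =>
  intro c hc hα
  set α := ∑ j, (c j : ℝ) • B j with hαdef
  -- a simple root with positive pairing
  obtain ⟨j, hj⟩ : ∃ j, 0 < (⟪B j, α⟫ : ℝ) := by
    by_contra hcon
    push Not at hcon
    have h1 : (⟪α, α⟫ : ℝ) ≤ 0 := by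
      conv_lhs => rw [hαdef, sum_inner]
      apply Finset.sum_nonpos
      intro j _
      rw [real_inner_smul_left, ← hαdef]
      exact mul_nonpos_of_nonneg_of_nonpos (by positivity) (hcon j)
    exact hΦ.ne_zero α hα (inner_self_eq_zero.mp (le_antisymm h1 real_inner_self_nonneg))
  have hBj := hB.mem j
  have hBj0 := hΦ.ne_zero _ hBj
  obtain ⟨k, hk⟩ := hΦ.crystallographic α hα _ hBj
  have hBB : 0 < (⟪B j, B j⟫ : ℝ) := real_inner_self_pos.mpr hBj0
  have hkpos : 0 < k := by
    have : (0:ℝ) < k := by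
      rw [← hk, inner_coroot_right, real_inner_comm (B j) α]
      exact mul_pos (div_pos two_pos hBB) hj
    exact_mod_cast this
  have hs : α - ⟪B j, α⟫ • coroot (B j) = α - (k : ℝ) • B j := by
    rw [← hk, inner_coroot_right, coroot, smul_smul, real_inner_comm]
    congr 2
    ring
  have hmem := hΦ.reflect_mem _ hBj α hα
  have hcr := coroot_reflect (B j) α hBj0
  obtain ⟨l, hl⟩ := hΦ.crystallographic _ hBj α hα
  have hexp : α - (k : ℝ) • B j = ∑ t, (((c t : ℤ) - (if t = j then k else 0) : ℤ) : ℝ) • B t := by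
    push_cast
    simp only [sub_smul, Finset.sum_sub_distrib]
    simp [hαdef]
  have huniq : ∀ d : Fin m → ℤ, α - (k : ℝ) • B j = ∑ t, (d t : ℝ) • B t →
      ∀ t, d t = (c t : ℤ) - (if t = j then k else 0) := by
    intro d hd t
    have h0 : ∑ t, ((d t : ℝ) - (((c t : ℤ) - (if t = j then k else 0) : ℤ) : ℝ)) • B t = 0 := by
      simp only [sub_smul, Finset.sum_sub_distrib]
      rw [← hd, ← hexp, sub_self]
    have := Fintype.linearIndependent_iff.mp hB.indep _ h0 t
    have h2 := sub_eq_zero.mp this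
    exact_mod_cast h2
  have hfin : coroot (α - (k : ℝ) • B j) ∈
      AddSubgroup.closure (Set.range fun j => coroot (B j)) →
      coroot α ∈ AddSubgroup.closure (Set.range fun j => coroot (B j)) := by
    intro h
    rw [← hs, hcr, hl, Int.cast_smul_eq_zsmul] at h
    have h3 := add_mem h (zsmul_mem (AddSubgroup.subset_closure
      (k := Set.range fun j => coroot (B j)) ⟨j, rfl⟩) l)
    simpa using h3
  rw [hs] at hmem
  rcases hB.decomp _ hmem with ⟨d, hd, hd0⟩ | ⟨d, hd, hd0⟩
  · apply hfin
    have hdu := huniq d hd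
    have hd' : α - (k : ℝ) • B j = ∑ t, ((d t).toNat : ℝ) • B t := by
      rw [hd]
      refine Finset.sum_congr rfl fun t _ => ?_
      have h4 : (((d t).toNat : ℤ) : ℝ) = (d t : ℝ) := by rw [Int.toNat_of_nonneg (hd0 t)]
      rw [← h4, Int.cast_natCast]
    rw [hd']
    refine ih (∑ t, (d t).toNat) ?_ _ rfl (hd' ▸ hmem)
    rw [← hc]
    apply Finset.sum_lt_sum
    · intro t _
      have := hdu t
      split_ifs at this <;> omega
    · refine ⟨j, Finset.mem_univ _, ?_⟩
      have := hdu j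
      have := hd0 j
      simp only [if_true] at *
      omega
  · -- then `α` is a multiple of `B j`
    have hdu := huniq d hd
    have hz : ∀ t, t ≠ j → c t = 0 := by
      intro t ht
      have h1 := hdu t
      have h2 := hd0 t
      simp only [if_neg ht] at h1
      omega
    have hαj : α = (c j : ℝ) • B j := by
      rw [hαdef]
      apply Finset.sum_eq_single j
      · intro t _ ht; simp [hz t ht]
      · simp
    rcases hΦ.reduced _ hBj (c j : ℝ) (hαj ▸ hα) with h | h
    · rw [hαj, h, one_smul]
      exact AddSubgroup.subset_closure ⟨j, rfl⟩
    · have : (0:ℝ) ≤ (c j : ℝ) := by positivity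
      linarith

lemma coroot_mem_simple {Φ : Set (E m)} (hΦ : IsRootSystem Φ) {B : Fin m → E m}
    (hB : IsSimpleSystem Φ B) {α : E m} (hα : α ∈ Φ) :
    coroot α ∈ AddSubgroup.closure (Set.range fun j => coroot (B j)) := by
  have hneg : -α ∈ Φ := by
    have := hΦ.reflect_mem α hα α hα
    have h2 : α - ⟪α, α⟫ • coroot α = -α := by
      rw [coroot, smul_smul, mul_div_cancel₀ _ ((inner_self_ne_zero (𝕜 := ℝ)).mpr
        (hΦ.ne_zero α hα)), two_smul]
      abel
    rwa [h2] at this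
  rcases hB.decomp α hα with ⟨c, hc, h0⟩ | ⟨c, hc, h0⟩
  · have : α = ∑ t, ((c t).toNat : ℝ) • B t := by
      rw [hc]
      refine Finset.sum_congr rfl fun t _ => ?_
      have h4 : (((c t).toNat : ℤ) : ℝ) = (c t : ℝ) := by rw [Int.toNat_of_nonneg (h0 t)]
      rw [← h4, Int.cast_natCast]
    rw [this]
    exact coroot_mem_pos hΦ hB _ _ rfl (this ▸ hα)
  · have : -α = ∑ t, ((-c t).toNat : ℝ) • B t := by
      rw [hc, ← Finset.sum_neg_distrib]
      refine Finset.sum_congr rfl fun t _ => ?_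
      have h4 : (((-c t).toNat : ℤ) : ℝ) = ((-c t : ℤ) : ℝ) := by
        rw [Int.toNat_of_nonneg (by have := h0 t; omega)]
      rw [← neg_smul]
      congr 1
      rw [Int.cast_natCast] at h4
      rw [h4]; simp
    rw [← neg_neg (coroot α), ← coroot_neg]
    apply neg_mem
    rw [this]
    exact coroot_mem_pos hΦ hB _ _ rfl (this ▸ hneg)

lemma inner_omega_lattice {Φ : Set (E m)} (hΦ : IsRootSystem Φ) {B ω : Fin m → E m}
    (hB : IsSimpleSystem Φ B) (hω : IsFundamentalCoweights B ω) (i : Fin m) {q : E m}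
    (hq : q ∈ AddSubgroup.closure (coroot '' Φ)) :
    ∃ n : ℤ, ⟪ω i, q⟫ = (n : ℝ) * ⟪ω i, coroot (B i)⟫ := by
  have hq' : q ∈ AddSubgroup.closure (Set.range fun j => coroot (B j)) := by
    refine (AddSubgroup.closure_le _).mpr ?_ hq
    rintro _ ⟨α, hα, rfl⟩
    exact coroot_mem_simple hΦ hB hα
  clear hq
  induction hq' using AddSubgroup.closure_induction with
  | mem x hx =>
    obtain ⟨j, rfl⟩ := hx
    by_cases h : j = i
    · exact ⟨1, by simp [h]⟩
    · refine ⟨0, ?_⟩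
      have := hω j i
      rw [if_neg h] at this
      simp only [inner_coroot_right (ω i) (B j)]
      rw [real_inner_comm (B j) (ω i), this]; simp
  | zero => exact ⟨0, by simp⟩
  | add x y _ _ hx hy =>
    obtain ⟨a, ha⟩ := hx
    obtain ⟨b, hb⟩ := hy
    exact ⟨a + b, by rw [inner_add_right, ha, hb]; push_cast; ring⟩
  | neg x _ hx =>
    obtain ⟨a, ha⟩ := hx
    exact ⟨-a, by rw [inner_neg_right, ha]; push_cast; ring⟩

/-! ### Tubes -/

/-- No wall of `Ψ` separates `x` and `y`. -/
def SameSide (Ψ : Set (E m)) (x y : E m) : Prop :=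
  ∀ α ∈ Ψ, ∀ k : ℤ, ⟪α, x⟫ < (k : ℝ) ↔ ⟪α, y⟫ < (k : ℝ)

lemma not_mem_tubeWalls {Φ : Set (E m)} {β x : E m} :
    x ∈ (tubeWalls Φ β)ᶜ ↔ ∀ α ∈ PhiI Φ β, ∀ k : ℤ, ⟪α, x⟫ ≠ (k : ℝ) := by
  unfold tubeWalls PhiI wall
  simp only [Set.mem_compl_iff, Set.mem_iUnion, Set.mem_ofPred_eq, exists_prop, not_exists,
    not_and, ne_eq]

lemma mem_component_iff {Φ : Set (E m)} {β x y : E m} (hx : x ∈ (tubeWalls Φ β)ᶜ) :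
    y ∈ connectedComponentIn (tubeWalls Φ β)ᶜ x ↔
      y ∈ (tubeWalls Φ β)ᶜ ∧ SameSide (PhiI Φ β) x y := by
  constructor
  · intro hy
    have hsub := connectedComponentIn_subset (tubeWalls Φ β)ᶜ x
    refine ⟨hsub hy, ?_⟩
    intro α hα k
    have hpre : IsPreconnected ((fun z : E m => (⟪α, z⟫ : ℝ)) ''
        connectedComponentIn (tubeWalls Φ β)ᶜ x) :=
      isPreconnected_connectedComponentIn.image _ (by fun_prop)
    have hord := hpre.ordConnected
    have hxm : (⟪α, x⟫ : ℝ) ∈ ((fun z : E m => (⟪α, z⟫ : ℝ)) ''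
        connectedComponentIn (tubeWalls Φ β)ᶜ x) := ⟨x, mem_connectedComponentIn hx, rfl⟩
    have hym : (⟪α, y⟫ : ℝ) ∈ ((fun z : E m => (⟪α, z⟫ : ℝ)) ''
        connectedComponentIn (tubeWalls Φ β)ᶜ x) := ⟨y, hy, rfl⟩
    have hk : (k : ℝ) ∉ ((fun z : E m => (⟪α, z⟫ : ℝ)) ''
        connectedComponentIn (tubeWalls Φ β)ᶜ x) := by
      rintro ⟨z, hz, hzk⟩
      exact not_mem_tubeWalls.mp (hsub hz) α hα k hzk
    constructor
    · intro h
      by_contra hcon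
      exact hk (hord.out hxm hym ⟨h.le, not_lt.mp hcon⟩)
    · intro h
      by_contra hcon
      exact hk (hord.out hym hxm ⟨h.le, not_lt.mp hcon⟩)
  · rintro ⟨hy, hs⟩
    have hseg : segment ℝ x y ⊆ (tubeWalls Φ β)ᶜ := by
      intro z hz
      rw [not_mem_tubeWalls] at hx hy ⊢
      intro α hα k hk
      obtain ⟨a, b, ha, hb, hab, rfl⟩ := hz
      rw [inner_add_right, real_inner_smul_right, real_inner_smul_right] at hk
      have h1 := hs α hα k
      have h2 := hx α hα k
      have h3 := hy α hα k
      have ha' : a = 1 - b := by linarith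
      rcases lt_or_gt_of_ne h2 with h | h
      · have h4 := h1.mp h
        rcases ha.eq_or_lt with h5 | h5
        · have hb1 : b = 1 := by linarith
          subst hb1; rw [← h5] at hk; linarith
        · have e1 := mul_lt_mul_of_pos_left h h5
          have e2 := mul_le_mul_of_nonneg_left h4.le hb
          have e3 : a * (k : ℝ) + b * k = k := by rw [← add_mul, hab, one_mul]
          linarith
      · have h4 : (k : ℝ) < ⟪α, y⟫ := by
          refine lt_of_le_of_ne (not_lt.mp fun h' => ?_) (Ne.symm h3)
          exact absurd (h1.mpr h') (not_lt.mpr h.le)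
        rcases ha.eq_or_lt with h5 | h5
        · have hb1 : b = 1 := by linarith
          subst hb1; rw [← h5] at hk; linarith
        · have e1 := mul_lt_mul_of_pos_left h h5
          have e2 := mul_le_mul_of_nonneg_left h4.le hb
          have e3 : a * (k : ℝ) + b * k = k := by rw [← add_mul, hab, one_mul]
          linarith
    exact (convex_segment x y).isPreconnected.subset_connectedComponentIn
      (left_mem_segment ℝ x y) hseg (right_mem_segment ℝ x y)

lemma Waff_mono {Ψ Φ : Set (E m)} (h : Ψ ⊆ Φ) : Waff Ψ ≤ Waff Φ := by
  apply Subgroup.closure_mono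
  rintro w ⟨α, hα, k, rfl⟩
  exact ⟨α, h hα, k, rfl⟩

lemma PhiI_subset (Φ : Set (E m)) (β : E m) : PhiI Φ β ⊆ Φ := fun _ h => h.1

/-- Orbits of the affine Weyl group are locally finite. -/
lemma orbit_ball_finite {Φ : Set (E m)} (hΦ : IsRootSystem Φ) {B : Fin m → E m}
    (hB : IsSimpleSystem Φ B) (y z : E m) (R : ℝ) :
    {p : E m | (∃ u ∈ Waff Φ, p = u z) ∧ dist y p ≤ R}.Finite := by
  let f : E m → (Fin m → ℝ) := fun p j => ⟪B j, p⟫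
  have hf : Function.Injective f := by
    intro p q hpq
    rw [← sub_eq_zero]
    apply eq_zero_of_inner_simple hB
    intro j
    rw [inner_sub_right, sub_eq_zero]
    exact congrFun hpq j
  let S : Fin m → Set ℝ := fun j => ⋃ γ ∈ Φ,
    (fun n : ℤ => ⟪γ, z⟫ + (n : ℝ)) '' {n : ℤ | |(n : ℝ)| ≤ ‖B j‖ * (R + ‖y‖) + |⟪γ, z⟫|}
  have hS : ∀ j, (S j).Finite := by
    intro j
    refine hΦ.finite.biUnion fun γ _ => Set.Finite.image _ ?_
    refine (Set.finite_Icc (-⌈‖B j‖ * (R + ‖y‖) + |⟪γ, z⟫|⌉)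
      ⌈‖B j‖ * (R + ‖y‖) + |⟪γ, z⟫|⌉).subset ?_
    intro n hn
    have hn' := abs_le.mp hn.out
    have hc := Int.le_ceil (‖B j‖ * (R + ‖y‖) + |⟪γ, z⟫|)
    constructor
    · have : ((-⌈‖B j‖ * (R + ‖y‖) + |⟪γ, z⟫|⌉ : ℤ) : ℝ) ≤ n := by
        push_cast; linarith [hn'.1]
      exact_mod_cast this
    · have : (n : ℝ) ≤ (⌈‖B j‖ * (R + ‖y‖) + |⟪γ, z⟫|⌉ : ℤ) := by linarith [hn'.2]
      exact_mod_cast this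
  refine ((Set.Finite.pi' hS).preimage (hf.injOn)).subset ?_
  rintro p ⟨⟨u, hu, rfl⟩, hd⟩
  intro j
  obtain ⟨γ, hγ, n, hn⟩ := pair_of_mem hΦ le_rfl hΦ.reflect_mem hu (hB.mem j)
  simp only [S, Set.mem_iUnion]
  refine ⟨γ, hγ, n, ?_, (hn z).symm⟩
  show |(n : ℝ)| ≤ _
  have h1 : (n : ℝ) = ⟪B j, u z⟫ - ⟪γ, z⟫ := by rw [hn]; ring
  have h2 : |(⟪B j, u z⟫ : ℝ)| ≤ ‖B j‖ * ‖u z‖ := abs_real_inner_le_norm _ _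
  have h3 : ‖u z‖ ≤ R + ‖y‖ := by
    have : ‖u z‖ ≤ ‖u z - y‖ + ‖y‖ := by simpa using norm_add_le (u z - y) y
    rw [dist_comm, dist_eq_norm] at hd
    linarith
  have h4 := mul_le_mul_of_nonneg_left h3 (norm_nonneg (B j))
  rw [h1]
  linarith [abs_sub (⟪B j, u z⟫ : ℝ) ⟪γ, z⟫]

lemma refl_dist (α : E m) (hα : α ≠ 0) (k : ℤ) (y p : E m) :
    dist y (affRefl α k p) ^ 2 = dist y p ^ 2 +
      (4 / ⟪α, α⟫) * ((⟪α, p⟫ - k) * (⟪α, y⟫ - k)) := by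
  have h := (inner_self_ne_zero (𝕜 := ℝ)).mpr hα
  have e : y - affRefl α k p = (y - p) + (⟪α, p⟫ - (k : ℝ)) • coroot α := by
    rw [affRefl_apply]; abel
  rw [dist_eq_norm, dist_eq_norm, e, norm_add_sq_real, ← real_inner_self_eq_norm_sq
    ((⟪α, p⟫ - (k : ℝ)) • coroot α), real_inner_smul_right, real_inner_smul_right,
    real_inner_smul_left, inner_coroot_right, inner_coroot_right (coroot α),
    real_inner_comm α (coroot α), inner_coroot_self hα, inner_sub_left, real_inner_comm α y,
    real_inner_comm α p]
  field_simp
  ring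

/-- The affine reflections in the tube walls act transitively on tubes. -/
lemma tube_transitive {Φ : Set (E m)} (hΦ : IsRootSystem Φ) {B : Fin m → E m}
    (hB : IsSimpleSystem Φ B) (β y z : E m) (hy : y ∈ (tubeWalls Φ β)ᶜ)
    (hz : z ∈ (tubeWalls Φ β)ᶜ) :
    ∃ u ∈ Waff (PhiI Φ β), SameSide (PhiI Φ β) y (u z) := by
  let O : Set (E m) := {p | (∃ u ∈ Waff (PhiI Φ β), p = u z) ∧ dist y p ≤ dist y z}
  have hO : O.Finite := by
    refine (orbit_ball_finite hΦ hB y z (dist y z)).subset ?_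
    rintro p ⟨⟨u, hu, h⟩, hd⟩
    exact ⟨⟨u, Waff_mono (PhiI_subset Φ β) hu, h⟩, hd⟩
  have hne : O.Nonempty := ⟨z, ⟨1, one_mem _, rfl⟩, le_rfl⟩
  obtain ⟨p, ⟨⟨u, hu, rfl⟩, hpd⟩, hmin⟩ := hO.exists_minimalFor (fun p => dist y p) O hne
  have hmin' : ∀ v ∈ Waff (PhiI Φ β), dist y (u z) ≤ dist y (v z) := by
    intro v hv
    by_contra hcon
    push Not at hcon
    exact absurd (hmin ⟨⟨v, hv, rfl⟩, hcon.le.trans hpd⟩ hcon.le) (not_le.mpr hcon)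
  refine ⟨u, hu, ?_⟩
  intro α hα k
  have hα0 := hΦ.ne_zero α hα.1
  have hpos : 0 < (⟪α, α⟫ : ℝ) := real_inner_self_pos.mpr hα0
  have h1 := hmin' (affRefl α k * u)
    (mul_mem (Subgroup.subset_closure ⟨α, hα, k, rfl⟩) hu)
  rw [Equiv.Perm.mul_apply] at h1
  have h2 := pow_le_pow_left₀ dist_nonneg h1 2
  rw [refl_dist α hα0] at h2
  have h3 : 0 ≤ (⟪α, u z⟫ - (k:ℝ)) * (⟪α, y⟫ - k) := by
    have h4 : 0 ≤ (4 / ⟪α, α⟫) * ((⟪α, u z⟫ - (k:ℝ)) * (⟪α, y⟫ - k)) := by linarith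
    exact nonneg_of_mul_nonneg_right h4 (by positivity)
  have hyk := not_mem_tubeWalls.mp hy α hα k
  have huk : ⟪α, u z⟫ ≠ (k : ℝ) := by
    obtain ⟨γ, hγ, n, hn⟩ := pair_of_mem hΦ (PhiI_subset Φ β) (PhiI_reflect hΦ β) hu hα
    rw [hn]
    intro h
    apply not_mem_tubeWalls.mp hz γ hγ (k - n)
    push_cast
    linarith
  constructor
  · intro h
    by_contra hcon
    have : (k : ℝ) < ⟪α, u z⟫ := lt_of_le_of_ne (not_lt.mp hcon) huk.symm
    nlinarith
  · intro h
    by_contra hcon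
    have : (k : ℝ) < ⟪α, y⟫ := lt_of_le_of_ne (not_lt.mp hcon) hyk.symm
    nlinarith

/-! ### Finite order and fixed points -/

lemma finite_order {Φ : Set (E m)} (hΦ : IsRootSystem Φ) (L : E m ≃ₗᵢ[ℝ] E m)
    (hL : ∀ α ∈ Φ, L α ∈ Φ) : ∃ N : ℕ, 0 < N ∧ ∀ x, (L : E m → E m)^[N] x = x := by
  have hit : ∀ n : ℕ, ∀ α ∈ Φ, (L : E m → E m)^[n] α ∈ Φ := by
    intro n
    induction n with
    | zero => intro α h; exact h
    | succ n ih => intro α h; rw [Function.iterate_succ_apply']; exact hL _ (ih α h)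
  have : Finite Φ := hΦ.finite
  let g : ℕ → (Φ → Φ) := fun n α => ⟨(L : E m → E m)^[n] α, hit n α α.2⟩
  obtain ⟨a, b, hab, hg⟩ := Finite.exists_ne_map_eq_of_infinite g
  wlog hlt : a < b generalizing a b
  · exact this b a hab.symm hg.symm (by omega)
  refine ⟨b - a, by omega, ?_⟩
  have hroot : ∀ α ∈ Φ, (L : E m → E m)^[b - a] α = α := by
    intro α hα
    have h1 : (L : E m → E m)^[a] α = (L : E m → E m)^[b] α :=
      congrArg Subtype.val (congrFun hg ⟨α, hα⟩)
    have h2 : b = a + (b - a) := by omega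
    rw [h2, Function.iterate_add_apply] at h1
    exact ((L.injective.iterate a) h1).symm
  have hlin : ∀ n : ℕ, (L : E m → E m)^[n] = ((L.toLinearEquiv.toLinearMap ^ n : E m →ₗ[ℝ] E m)) := by
    intro n
    rw [Module.End.coe_pow]
    rfl
  have heq : (L.toLinearEquiv.toLinearMap ^ (b - a) : E m →ₗ[ℝ] E m) = LinearMap.id := by
    apply LinearMap.ext_on hΦ.span_eq_top
    intro α hα
    rw [← hlin]
    exact hroot α hα
  intro x
  rw [hlin, heq]
  rfl

lemma fixed_of_periodic (F : E m → E m) (L : E m ≃ₗᵢ[ℝ] E m) (q : E m)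
    (hF : ∀ x, F x = L x + q) (N : ℕ) (hN : 0 < N) (x : E m) (hx : F^[N] x = x) :
    ∃ x1, F x1 = x1 := by
  refine ⟨(N : ℝ)⁻¹ • ∑ k ∈ Finset.range N, F^[k] x, ?_⟩
  have hN' : (N : ℝ) ≠ 0 := by positivity
  have hq : q = (N : ℝ)⁻¹ • ∑ k ∈ Finset.range N, q := by
    rw [Finset.sum_const, Finset.card_range, ← Nat.cast_smul_eq_nsmul ℝ, smul_smul,
      inv_mul_cancel₀ hN', one_smul]
  rw [hF, map_smul, map_sum]
  conv_lhs => rw [hq]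
  rw [← smul_add, ← Finset.sum_add_distrib]
  congr 1
  simp only [← hF, ← Function.iterate_succ_apply' F]
  have h1 := Finset.sum_range_succ (fun k => F^[k] x) N
  have h2 := Finset.sum_range_succ' (fun k => F^[k] x) N
  rw [h2, hx] at h1
  simpa using h1

lemma iterate_sub (F : E m → E m) (L : E m ≃ₗᵢ[ℝ] E m) (q : E m)
    (hF : ∀ x, F x = L x + q) (n : ℕ) (x y : E m) :
    F^[n] x - F^[n] y = (L : E m → E m)^[n] (x - y) := by
  induction n with
  | zero => rfl
  | succ n ih =>
    rw [Function.iterate_succ_apply', Function.iterate_succ_apply',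
      Function.iterate_succ_apply', ← ih, hF, hF, map_sub]
    abel

/-- `f` permutes the walls of `Ψ` compatibly. -/
def PairMap (Ψ : Set (E m)) (f : E m → E m) : Prop :=
  ∀ α ∈ Ψ, ∃ γ ∈ Ψ, ∃ n : ℤ, ∀ x, ⟪α, f x⟫ = ⟪γ, x⟫ + (n : ℝ)

lemma PairMap.same {Ψ : Set (E m)} {f : E m → E m} (hf : PairMap Ψ f) {x y : E m}
    (h : SameSide Ψ x y) : SameSide Ψ (f x) (f y) := by
  intro α hα k
  obtain ⟨γ, hγ, n, hn⟩ := hf α hα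
  have := h γ hγ (k - n)
  push_cast at this
  rw [hn, hn, ← lt_sub_iff_add_lt, ← lt_sub_iff_add_lt]
  exact this

lemma PairMap.compl {Φ : Set (E m)} {β : E m} {f : E m → E m} (hf : PairMap (PhiI Φ β) f)
    {x : E m} (h : x ∈ (tubeWalls Φ β)ᶜ) : f x ∈ (tubeWalls Φ β)ᶜ := by
  rw [not_mem_tubeWalls] at h ⊢
  intro α hα k hk
  obtain ⟨γ, hγ, n, hn⟩ := hf α hα
  apply h γ hγ (k - n)
  rw [hn] at hk
  push_cast
  linarith

lemma SameSide.trans {Ψ : Set (E m)} {x y z : E m} (h : SameSide Ψ x y) (h' : SameSide Ψ y z) :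
    SameSide Ψ x z := fun α hα k => (h α hα k).trans (h' α hα k)

lemma SameSide.symm {Ψ : Set (E m)} {x y : E m} (h : SameSide Ψ x y) :
    SameSide Ψ y x := fun α hα k => (h α hα k).symm

/-- Points on the same side of all walls have pairings at distance at most one. -/
lemma SameSide.abs_le {Ψ : Set (E m)} {x y : E m} (h : SameSide Ψ x y) {α : E m} (hα : α ∈ Ψ) :
    ⟪α, y⟫ - ⟪α, x⟫ ≤ (1 : ℝ) := by
  have h1 := (h α hα (⌊(⟪α, x⟫ : ℝ)⌋ + 1)).mp (by push_cast; exact Int.lt_floor_add_one _)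
  push_cast at h1
  linarith [Int.floor_le (⟪α, x⟫ : ℝ)]

/-- An isometry moving the `β`-coordinate by a constant, and translating some point along
`β`, is hyperbolic with that translation vector. -/
lemma hyperbolic_of_fixed {f : E m → E m} {β : E m} {c : ℝ} (hβ : β ≠ 0) (hc : 0 < c)
    (hf : ∀ x, ⟪β, f x - x⟫ = c * ⟪β, β⟫) {x1 : E m} (hx1 : f x1 = x1 + c • β) :
    IsHyperbolic f ∧ HasTransVec f (c • β) := by
  have hnb : 0 < ‖β‖ := norm_pos_iff.mpr hβ
  have hsq : ∀ x, dist x (f x) ^ 2 = (c * ‖β‖) ^ 2 + ‖f x - x - c • β‖ ^ 2 := by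
    intro x
    rw [dist_comm, dist_eq_norm, norm_sub_sq_real (f x - x), real_inner_smul_right,
      real_inner_comm β (f x - x), hf,
      norm_smul, Real.norm_of_nonneg hc.le, real_inner_self_eq_norm_sq]
    ring
  have hge : ∀ x, c * ‖β‖ ≤ dist x (f x) := by
    intro x
    apply le_of_sq_le_sq _ dist_nonneg
    rw [hsq]
    nlinarith [sq_nonneg ‖f x - x - c • β‖]
  have hx1d : dist x1 (f x1) = c * ‖β‖ := by
    rw [hx1, dist_comm, dist_eq_norm, add_sub_cancel_left, norm_smul, Real.norm_of_nonneg hc.le]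
  have hmin : minDisp f = c * ‖β‖ := by
    unfold minDisp
    apply le_antisymm
    · rw [← hx1d]
      exact ciInf_le ⟨c * ‖β‖, by rintro _ ⟨x, rfl⟩; exact hge x⟩ x1
    · exact le_ciInf hge
  refine ⟨⟨⟨x1, ?_⟩, ?_⟩, ?_⟩
  · show dist x1 (f x1) = minDisp f
    rw [hx1d, hmin]
  · rw [hmin]; positivity
  · intro x hx
    have h1 : dist x (f x) = c * ‖β‖ := by rw [← hmin]; exact hx
    have h2 := hsq x
    rw [h1] at h2
    have h3 : ‖f x - x - c • β‖ = 0 := by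
      have : ‖f x - x - c • β‖ ^ 2 = 0 := by linarith
      exact pow_eq_zero_iff (two_ne_zero) |>.mp this
    have h4 := norm_eq_zero.mp h3
    rw [sub_sub, sub_eq_zero] at h4
    exact h4

/-- Lower bound: the coefficient of any hyperbolic element is at least the claimed one. -/
lemma coeff_lower_bound {Φ : Set (E m)} (hΦ : IsRootSystem Φ) {B ω : Fin m → E m}
    (hB : IsSimpleSystem Φ B) (hω : IsFundamentalCoweights B ω) (i : Fin m)
    (hβ : 0 < (⟪ω i, ω i⟫ : ℝ)) (hβα : 0 < (⟪ω i, coroot (B i)⟫ : ℝ))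
    {w : Equiv.Perm (E m)} (hw : w ∈ Waff Φ) (hyp : IsHyperbolic (w : E m → E m)) {c : ℝ}
    (hc : HasTransVec (w : E m → E m) (c • ω i)) (hpos : 0 < c) :
    ⟪ω i, coroot (B i)⟫ / ⟪ω i, ω i⟫ ≤ c := by
  obtain ⟨L, q, hq, h1, -⟩ := affDesc_of_mem hΦ.reflect_mem hw
  obtain ⟨⟨x, hx⟩, -⟩ := hyp
  have hiso : ∀ a b, dist (w a) (w b) = dist a b := by
    intro a b
    rw [h1, h1, dist_add_right, L.dist_map]
  have hwx : w x ∈ minSet (w : E m → E m) := by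
    show dist (w x) (w (w x)) = _
    rw [hiso]; exact hx
  have e1 := hc x hx
  have e2 := hc (w x) hwx
  have hLβ : L (ω i) = ω i := by
    have h3 : L (c • ω i) = c • ω i := by
      have h4 : w (w x) - w x = L (w x - x) := by rw [h1 (w x), h1 x, map_sub]; abel
      rw [e2, e1] at h4
      simpa using h4.symm
    rw [map_smul] at h3
    exact smul_right_injective _ hpos.ne' h3
  have e3 : c * ⟪ω i, ω i⟫ = (⟪ω i, q⟫ : ℝ) := by
    have h5 : (⟪ω i, w x⟫ : ℝ) = ⟪ω i, x⟫ + ⟪ω i, q⟫ := by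
      rw [h1, inner_add_right]
      congr 1
      conv_lhs => rw [← hLβ]
      exact L.inner_map_map _ _
    rw [e1, inner_add_right, real_inner_smul_right] at h5
    linarith
  obtain ⟨n, hn⟩ := inner_omega_lattice hΦ hB hω i hq
  rw [hn] at e3
  have hnpos : 0 < n := by
    have h6 : 0 < (n : ℝ) * ⟪ω i, coroot (B i)⟫ := by rw [← e3]; positivity
    exact_mod_cast (mul_pos_iff_of_pos_right hβα).mp h6
  have hn1 : (1 : ℝ) ≤ n := by exact_mod_cast hnpos
  rw [div_le_iff₀ hβ, e3]
  nlinarith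

/-- Existence of a hyperbolic stabilizer with the claimed coefficient. -/
lemma exists_stab {Φ : Set (E m)} (hΦ : IsRootSystem Φ) {B ω : Fin m → E m}
    (hB : IsSimpleSystem Φ B) (hω : IsFundamentalCoweights B ω) (i : Fin m)
    (hβ : 0 < (⟪ω i, ω i⟫ : ℝ)) (hβα : 0 < (⟪ω i, coroot (B i)⟫ : ℝ))
    {T : Set (E m)} (hT : IsGeodesicTube Φ (ω i) T) :
    ∃ w : Equiv.Perm (E m), IsHypStab Φ T w ∧
      HasTransVec (w : E m → E m) ((⟪ω i, coroot (B i)⟫ / ⟪ω i, ω i⟫ : ℝ) • ω i) := by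
  obtain ⟨x0, hx0, rfl⟩ := hT
  have hBi := hB.mem i
  have hBi0 := hΦ.ne_zero _ hBi
  set β := ω i with hβdef
  set c : ℝ := ⟪β, coroot (B i)⟫ / ⟪β, β⟫ with hcdef
  have hcpos : 0 < c := div_pos hβα hβ
  have hcβ : c * ⟪β, β⟫ = ⟪β, coroot (B i)⟫ := div_mul_cancel₀ _ hβ.ne'
  let t : Equiv.Perm (E m) := affRefl (B i) 1 * affRefl (B i) 0
  have ht : ∀ x, t x = x + coroot (B i) := by
    intro x
    show affRefl (B i) 1 (affRefl (B i) 0 x) = _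
    rw [affRefl_apply, affRefl_apply, inner_sub_right, real_inner_smul_right,
      inner_coroot_self hBi0, sub_sub, ← add_smul]
    push_cast
    rw [show ((⟪B i, x⟫ : ℝ) - 0 + (⟪B i, x⟫ - (⟪B i, x⟫ - 0) * 2 - 1)) = -1 by ring]
    simp
  have htm : t ∈ Waff Φ := mul_mem (Subgroup.subset_closure ⟨_, hBi, _, rfl⟩)
    (Subgroup.subset_closure ⟨_, hBi, _, rfl⟩)
  have hPt : PairMap (PhiI Φ β) t := by
    intro α hα
    obtain ⟨n, hn⟩ := hΦ.crystallographic α hα.1 _ hBi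
    exact ⟨α, hα, n, fun x => by rw [ht, inner_add_right, hn]⟩
  obtain ⟨u, hu, hus⟩ := tube_transitive hΦ hB β x0 (t x0) hx0 (hPt.compl hx0)
  have hPu : ∀ v ∈ Waff (PhiI Φ β), PairMap (PhiI Φ β) v := fun v hv α hα =>
    pair_of_mem hΦ (PhiI_subset Φ β) (PhiI_reflect hΦ β) hv hα
  let w : Equiv.Perm (E m) := u * t
  have hwm : w ∈ Waff Φ := mul_mem (Waff_mono (PhiI_subset Φ β) hu) htm
  have hPw : PairMap (PhiI Φ β) w := by
    intro α hα
    obtain ⟨γ, hγ, n, hn⟩ := hPu u hu α hα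
    obtain ⟨δ, hδ, k, hk⟩ := hPt γ hγ
    refine ⟨δ, hδ, k + n, fun x => ?_⟩
    show ⟪α, u (t x)⟫ = _
    rw [hn, hk]; push_cast; ring
  have htinv : ∀ x, t⁻¹ x = x - coroot (B i) := by
    intro x
    rw [Equiv.Perm.inv_eq_iff_eq, ht]; simp
  have hPwi : PairMap (PhiI Φ β) (w⁻¹ : Equiv.Perm (E m)) := by
    intro α hα
    obtain ⟨γ, hγ, n, hn⟩ := hPu u⁻¹ (inv_mem hu) α hα
    obtain ⟨k, hk⟩ := hΦ.crystallographic α hα.1 _ hBi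
    refine ⟨γ, hγ, n - k, fun x => ?_⟩
    have : (w⁻¹ : Equiv.Perm (E m)) x = t⁻¹ (u⁻¹ x) := by
      simp only [w, mul_inv_rev, Equiv.Perm.mul_apply]
    rw [this, htinv, inner_sub_right, hn, hk]; push_cast; ring
  have hwx0 : SameSide (PhiI Φ β) x0 (w x0) := hus
  have hwβ : ∀ x, (⟪β, w x - x⟫ : ℝ) = c * ⟪β, β⟫ := by
    intro x
    have : (⟪β, w x⟫ : ℝ) = ⟪β, t x⟫ := inner_fix_of_mem hu (t x)
    rw [inner_sub_right, this, ht, inner_add_right, hcβ]; ring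
  -- the fixed point
  obtain ⟨L, q, hq, hwL, hLΦ⟩ := affDesc_of_mem hΦ.reflect_mem hwm
  let F : E m → E m := fun x => w x - c • β
  have hF : ∀ x, F x = L x + (q - c • β) := by
    intro x
    show w x - c • β = _
    rw [hwL]; abel
  have hPF : PairMap (PhiI Φ β) F := by
    intro α hα
    obtain ⟨γ, hγ, n, hn⟩ := hPw α hα
    refine ⟨γ, hγ, n, fun x => ?_⟩
    show ⟪α, w x - c • β⟫ = _
    rw [inner_sub_right, real_inner_smul_right, hα.2, hn]; ring
  have hFx0 : SameSide (PhiI Φ β) x0 (F x0) := by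
    refine hwx0.trans ?_
    intro α hα k
    show _ ↔ ⟪α, w x0 - c • β⟫ < _
    rw [inner_sub_right, real_inner_smul_right, hα.2, mul_zero, sub_zero]
  have hFn : ∀ n : ℕ, SameSide (PhiI Φ β) x0 (F^[n] x0) := by
    intro n
    induction n with
    | zero => exact fun _ _ _ => Iff.rfl
    | succ n ih =>
      rw [Function.iterate_succ_apply']
      exact hFx0.trans (hPF.same ih)
  have hFβ : ∀ n : ℕ, ∀ x, (⟪β, F^[n] x⟫ : ℝ) = ⟪β, x⟫ := by
    intro n x
    induction n with
    | zero => rfl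
    | succ n ih =>
      rw [Function.iterate_succ_apply', ← ih]
      show ⟪β, w (F^[n] x) - c • β⟫ = _
      have := hwβ (F^[n] x)
      rw [inner_sub_right] at this
      rw [inner_sub_right, real_inner_smul_right]
      linarith
  obtain ⟨N, hN, hLN⟩ := finite_order hΦ L (fun α h => (hLΦ α h).1)
  let τ : E m := F^[N] x0 - x0
  have hFN : ∀ x, F^[N] x = x + τ := by
    intro x
    have h1 := iterate_sub F L _ hF N x x0
    rw [hLN] at h1
    show _ = x + (F^[N] x0 - x0)
    rw [sub_eq_iff_eq_add] at h1
    rw [h1]; abel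
  have hFk : ∀ k : ℕ, F^[N * k] x0 = x0 + (k : ℝ) • τ := by
    intro k
    induction k with
    | zero => simp
    | succ k ih =>
      rw [Nat.mul_succ, Nat.add_comm, Function.iterate_add_apply, ih, hFN]
      push_cast
      rw [add_smul, one_smul, add_assoc]
  have hτα : ∀ α ∈ PhiI Φ β, (⟪α, τ⟫ : ℝ) = 0 := by
    intro α hα
    by_contra hne
    obtain ⟨k, hk⟩ := exists_nat_gt (1 / |(⟪α, τ⟫ : ℝ)|)
    have habs : 0 < |(⟪α, τ⟫ : ℝ)| := abs_pos.mpr hne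
    rw [div_lt_iff₀ habs] at hk
    have h1 := (hFn (N * k)).abs_le hα
    have h2 := (hFn (N * k)).symm.abs_le hα
    rw [hFk, inner_add_right, real_inner_smul_right] at h1 h2
    rcases abs_cases (⟪α, τ⟫ : ℝ) with ⟨h, _⟩ | ⟨h, _⟩ <;> rw [h] at hk <;> linarith
  have hτβ : (⟪β, τ⟫ : ℝ) = 0 := by
    show ⟪β, F^[N] x0 - x0⟫ = _
    rw [inner_sub_right, hFβ, sub_self]
  have hτ : τ = 0 := by
    have h1 : τ - (⟪B i, τ⟫ : ℝ) • β = 0 := by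
      apply eq_zero_of_inner_simple hB
      intro j
      have h2 := hω j i
      rw [← hβdef] at h2
      rw [inner_sub_right, real_inner_smul_right, h2]
      by_cases hj : j = i
      · simp [hj]
      · rw [if_neg hj] at h2 ⊢
        rw [hτα (B j) ⟨hB.mem j, h2⟩]; simp
    rw [sub_eq_zero] at h1
    rw [h1, real_inner_smul_right] at hτβ
    rcases mul_eq_zero.mp hτβ with h | h
    · rw [h1, h, zero_smul]
    · exact absurd h hβ.ne'
  obtain ⟨x1, hx1⟩ := fixed_of_periodic F L _ hF N hN x0 (by rw [hFN, hτ, add_zero])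
  have hβ0 : β ≠ 0 := by
    intro h
    rw [h] at hβ
    simp at hβ
  have hmain := hyperbolic_of_fixed (f := w) hβ0 hcpos hwβ (x1 := x1)
    (sub_eq_iff_eq_add.mp hx1)
  refine ⟨w, ⟨hwm, hmain.1, ?_⟩, hmain.2⟩
  ext y
  constructor
  · rintro ⟨x, hx, rfl⟩
    rw [mem_component_iff hx0] at hx ⊢
    exact ⟨hPw.compl hx.1, hwx0.trans (hPw.same hx.2)⟩
  · intro hy
    rw [mem_component_iff hx0] at hy
    refine ⟨w⁻¹ y, ?_, by simp⟩
    rw [mem_component_iff hx0]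
    refine ⟨hPwi.compl hy.1, ?_⟩
    have := hPwi.same (hwx0.symm.trans hy.2)
    simpa using this

/-- The coefficient `c_{w_min}` of the hyperbolic generator of a geodesic
tube of direction `β∨ = ω_i∨` equals `(ω_i∨, α_i∨)/(ω_i∨, ω_i∨)`. -/
theorem hyperbolic_generator_coefficient {m : ℕ} (Φ : Set (E m)) (hΦ : IsRootSystem Φ)
    (B ω : Fin m → E m) (hB : IsSimpleSystem Φ B) (hω : IsFundamentalCoweights B ω)
    (i : Fin m) (T : Set (E m)) (hT : IsGeodesicTube Φ (ω i) T)
    (wmin : Equiv.Perm (E m)) (cmin : ℝ)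
    (hwmin : IsHypStab Φ T wmin)
    (hcmin : HasTransVec (wmin : E m → E m) (cmin • ω i)) (hcpos : 0 < cmin)
    (hminimal : ∀ w : Equiv.Perm (E m), IsHypStab Φ T w →
      ∀ c : ℝ, HasTransVec (w : E m → E m) (c • ω i) → 0 < c → cmin ≤ c) :
    cmin = ⟪ω i, coroot (B i)⟫ / ⟪ω i, ω i⟫ := by
  have hBi0 := hΦ.ne_zero _ (hB.mem i)
  have hii := hω i i
  rw [if_pos rfl] at hii
  have hβ : 0 < (⟪ω i, ω i⟫ : ℝ) := by
    apply real_inner_self_pos.mpr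
    intro h
    rw [h] at hii
    simp at hii
  have hβα : 0 < (⟪ω i, coroot (B i)⟫ : ℝ) := by
    rw [inner_coroot_right, real_inner_comm (B i) (ω i), hii, mul_one]
    exact div_pos two_pos (real_inner_self_pos.mpr hBi0)
  apply le_antisymm
  · obtain ⟨w, hw, hv⟩ := exists_stab hΦ hB hω i hβ hβα hT
    exact hminimal w hw _ hv (div_pos hβα hβ)
  · exact coeff_lower_bound hΦ hB hω i hβ hβα hwmin.1 hwmin.2.1 hcmin hcpos

end
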